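/- Let 𝐢 = (ι_1,…,ι_L) be a reduced word of the longest element w₀, and let 1 ≤ k ≤ L be an index such that ι_l ≠ ι_k for all l > k (i.e. the letter ι_k does not occur after position k). Then (ν_k, β_l) = 0 for all k < l ≤ L. Consequently, for every β ∈ Σ_ι ℤ_{≥0}α_ι and every 𝐦 ∈ KP(β), one has Σ_{t=1}^{k} 𝐦(β_t)(ν_k,β_t) = (ν_k, β). -/

import Mathlib

open scoped BigOperators Classical

namespace QDatumPaper

structure CartanADE (J : Type) [Fintype J] [DecidableEq J] where
  a : J → J → ℤ
  symm : ∀ ι j : J, a ι j = a j ι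
  diag : ∀ ι : J, a ι ι = 2
  offDiag : ∀ ι j : J, ι ≠ j → a ι j = 0 ∨ a ι j = -1
  posDef : ∀ v : J → ℚ, v ≠ 0 → 0 < ∑ ι : J, ∑ j : J, v ι * (a ι j : ℚ) * v j
  indec : ∀ s : Set J, s.Nonempty →
    (∀ ι ∈ s, ∀ j : J, a ι j = -1 → j ∈ s) → s = Set.univ

variable {J : Type} [Fintype J] [DecidableEq J]

/-- `j` lies in the `σ`-orbit of `ι`. -/
def SameOrbit (σ : Equiv.Perm J) (ι j : J) : Prop := ∃ k : ℕ, (σ ^ k) ι = j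

/-- The size `𝗌_{\barι}` of the `σ`-orbit of `ι`. -/
noncomputable def orbitSize (σ : Equiv.Perm J) (ι : J) : ℕ :=
  ((Finset.range (orderOf σ)).image fun k => (σ ^ k) ι).card

/-- A diagram automorphism of the Cartan matrix `C`: no two distinct vertices in a common
orbit are adjacent. -/
structure DiagAut (C : CartanADE J) where
  σ : Equiv.Perm J
  compat : ∀ ι j : J, C.a (σ ι) (σ j) = C.a ι j
  noAdj : ∀ (ι : J) (k : ℕ), (σ ^ k) ι ≠ ι → C.a ι ((σ ^ k) ι) ≠ -1

/-- Height function on `(J, σ)`. -/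
def IsHeightFunction (C : CartanADE J) (D : DiagAut C) (ξ : J → ℤ) : Prop :=
  (∀ ι j : J, C.a ι j = -1 → orbitSize D.σ ι = orbitSize D.σ j →
      |ξ ι - ξ j| = (orbitSize D.σ ι : ℤ)) ∧
  (∀ ι j : J, C.a ι j = -1 → orbitSize D.σ ι < orbitSize D.σ j →
      ∃! j0 : J, SameOrbit D.σ j j0 ∧ |ξ ι - ξ j0| = 1 ∧
        ∀ k : ℕ, k < orderOf D.σ → ξ ((D.σ ^ k) j0) = ξ j0 - 2 * (k : ℤ))

/-- Symmetric bilinear form on the root lattice `ℤ^J`. -/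
def pairing (C : CartanADE J) (v w : J → ℤ) : ℤ := ∑ ι : J, ∑ j : J, v ι * C.a ι j * w j

/-- Positive roots. -/
def posRoots (C : CartanADE J) : Set (J → ℤ) :=
  {v | (∀ ι : J, 0 ≤ v ι) ∧ v ≠ 0 ∧ pairing C v v = 2}

def simpleRoot (ι : J) : J → ℤ := fun j => if j = ι then 1 else 0

/-- Simple reflection `s_ι` on the root lattice. -/
def reflS (C : CartanADE J) (ι : J) (v : J → ℤ) : J → ℤ :=
  fun j => v j - (∑ κ : J, v κ * C.a κ ι) * simpleRoot ι j

/-- `applyRefls C [ι₁, …, ι_m] v = s_{ι₁}(s_{ι₂}(⋯ s_{ι_m}(v)⋯))`. -/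
def applyRefls (C : CartanADE J) (w : List J) (v : J → ℤ) : J → ℤ :=
  w.foldr (reflS C) v

/-- `β_k = s_{ι₁} ⋯ s_{ι_{k-1}} (α_{ι_k})`. -/
def betaOf (C : CartanADE J) {L : ℕ} (ii : Fin L → J) (k : Fin L) : J → ℤ :=
  applyRefls C ((List.ofFn ii).take k.1) (simpleRoot (ii k))

/-- `ii` is a reduced word of the longest element. -/
def IsReducedWord (C : CartanADE J) {L : ℕ} (ii : Fin L → J) : Prop :=
  L = (posRoots C).ncard ∧ Function.Injective (betaOf C ii) ∧
    ∀ k : Fin L, betaOf C ii k ∈ posRoots C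

def pairingQ (C : CartanADE J) (v w : J → ℚ) : ℚ :=
  ∑ ι : J, ∑ j : J, v ι * (C.a ι j : ℚ) * w j

def reflQ (C : CartanADE J) (ι : J) (v : J → ℚ) : J → ℚ :=
  fun j => v j - (∑ κ : J, v κ * (C.a κ ι : ℚ)) * (if j = ι then 1 else 0)

def applyReflsQ (C : CartanADE J) (w : List J) (v : J → ℚ) : J → ℚ :=
  w.foldr (reflQ C) v

/-- `Λ` is a system of fundamental weights: `(Λ_ι, α_j) = δ_{ιj}`. -/
def IsFundWeights (C : CartanADE J) (Λ : J → J → ℚ) : Prop :=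
  ∀ ι j : J, pairingQ C (Λ ι) (fun κ => (simpleRoot j κ : ℚ)) = if ι = j then 1 else 0

/-- `ν_k = -(s_{ι₁} ⋯ s_{ι_k})(Λ_{ι_k})`. -/
def nuOf (C : CartanADE J) {L : ℕ} (ii : Fin L → J) (Λ : J → J → ℚ) (k : Fin L) : J → ℚ :=
  - applyReflsQ C ((List.ofFn ii).take (k.1 + 1)) (Λ (ii k))

def betaQ (C : CartanADE J) {L : ℕ} (ii : Fin L → J) (k : Fin L) : J → ℚ :=
  fun j => (betaOf C ii k j : ℚ)

/-- The pairing `(ν_k, β_t)`. -/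
def nuBetaPair (C : CartanADE J) {L : ℕ} (ii : Fin L → J) (Λ : J → J → ℚ) (k t : Fin L) : ℚ :=
  pairingQ C (nuOf C ii Λ k) (betaQ C ii t)

/-- `m` is a Kostant partition of `β`. -/
def IsKP (C : CartanADE J) (β : J → ℤ) (m : (J → ℤ) → ℤ) : Prop :=
  (∀ v : J → ℤ, v ∉ posRoots C → m v = 0) ∧ (∀ v ∈ posRoots C, 0 ≤ m v) ∧
    ∑ᶠ v ∈ posRoots C, m v • v = β

/-- `ρ^ii(m)_r = Σ_{t ≤ r} m(β_t)(ν_r, β_t)`. -/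
def rhoOf (C : CartanADE J) {L : ℕ} (ii : Fin L → J) (Λ : J → J → ℚ)
    (m : (J → ℤ) → ℤ) (r : Fin L) : ℚ :=
  ∑ t ∈ Finset.univ.filter (fun t : Fin L => t ≤ r),
    (m (betaOf C ii t) : ℚ) * nuBetaPair C ii Λ r t

/-- The partial order `≼_ii` on Kostant partitions. -/
def kpLE (C : CartanADE J) {L : ℕ} (ii : Fin L → J) (Λ : J → J → ℚ)
    (m n : (J → ℤ) → ℤ) : Prop :=
  ∀ r : Fin L, rhoOf C ii Λ m r ≤ rhoOf C ii Λ n r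

/-- The height function obtained from `ξ` by applying sources `w = [ι₁, …, ι_k]`. -/
noncomputable def heightAfter (σ : Equiv.Perm J) (ξ : J → ℤ) (w : List J) : J → ℤ :=
  w.foldl (fun η ι => fun j => η j - if j = ι then 2 * (orbitSize σ ι : ℤ) else 0) ξ

def IsSource (C : CartanADE J) (ξ : J → ℤ) (ι : J) : Prop :=
  ∀ j : J, C.a ι j = -1 → ξ j < ξ ι

/-- `ii` is adapted to the Q-datum `(J, σ, ξ)`. -/
def IsAdapted (C : CartanADE J) (D : DiagAut C) (ξ : J → ℤ) {L : ℕ} (ii : Fin L → J) : Prop :=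
  ∀ k : Fin L, IsSource C (heightAfter D.σ ξ ((List.ofFn ii).take k.1)) (ii k)

/-- `(s_{ι_{k-1}} ⋯ s_{ι_1} ξ)_{ι_k}`, the second component of `Ω̃_Q(β_k)`. -/
noncomputable def heightAt (σ : Equiv.Perm J) (ξ : J → ℤ) {L : ℕ} (ii : Fin L → J) (k : Fin L) : ℤ :=
  heightAfter σ ξ ((List.ofFn ii).take k.1) (ii k)

/-- `x ∈ Im Ω̃_Q`. -/
def InImOmega (σ : Equiv.Perm J) (ξ : J → ℤ) {L : ℕ} (ii : Fin L → J) (x : J × ℤ) : Prop :=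
  ∃ k : Fin L, ii k = x.1 ∧ heightAt σ ξ ii k = x.2

/-- A single commutation move. -/
def CommStep (C : CartanADE J) {L : ℕ} (ii jj : Fin L → J) : Prop :=
  ∃ (k : ℕ) (h1 : k < L) (h2 : k + 1 < L),
    C.a (ii ⟨k, h1⟩) (ii ⟨k + 1, h2⟩) = 0 ∧
    jj = ii ∘ Equiv.swap (⟨k, h1⟩ : Fin L) ⟨k + 1, h2⟩

/-- Commutation equivalence of words. -/
def CommEquiv (C : CartanADE J) {L : ℕ} (ii jj : Fin L → J) : Prop :=
  Relation.ReflTransGen (CommStep C) ii jj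

/-- The orbits of `ι` and `j` are adjacent (`\barι ∼ \barj` in `I₀`). -/
def adjOrbit (C : CartanADE J) (σ : Equiv.Perm J) (ι j : J) : Prop :=
  ∃ ι' j' : J, SameOrbit σ ι ι' ∧ SameOrbit σ j j' ∧ C.a ι' j' = -1

/-- `c ι j` is the Cartan matrix `c_{\barι \barj}` of the folded algebra `𝔤₀`. -/
noncomputable def IsFoldedCartan (C : CartanADE J) (σ : Equiv.Perm J) (c : J → J → ℤ) : Prop :=
  ∀ ι j : J, (c ι j : ℚ) =
    if SameOrbit σ ι j then 2
    else if adjOrbit C σ ι j then -(max 1 ((orbitSize σ j : ℚ) / (orbitSize σ ι : ℚ)))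
    else 0

/-- The basis element `ϖ_{\barι, p}` of `𝒫_ℤ`, realized as a function on `J × ℤ`
(the indicator of `orbit(ι) × {p}`). -/
noncomputable def varpiF (σ : Equiv.Perm J) (ι : J) (p : ℤ) : (J × ℤ) → ℤ :=
  fun y => if SameOrbit σ ι y.1 ∧ y.2 = p then 1 else 0

/-- The ℓ-root `α_{\barι, p}`. -/
noncomputable def lrootF (σ : Equiv.Perm J) (c : J → J → ℤ) (ι : J) (p : ℤ) : (J × ℤ) → ℤ :=
  fun y => varpiF σ ι (p + (orbitSize σ ι : ℤ)) y + varpiF σ ι (p - (orbitSize σ ι : ℤ)) y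
    - (if (¬ SameOrbit σ ι y.1) ∧
          ∃ k : ℤ, 1 ≤ k ∧ k ≤ -(c y.1 ι) ∧ y.2 = p - c y.1 ι + 1 - 2 * k
       then 1 else 0)

/-- `(\barι, p + 𝗌_{\barι}) ∈ Î₀`, i.e. the index `(\barι,p)` gives a valid ℓ-root. -/
def ValidLRootIdx (σ : Equiv.Perm J) (ξ : J → ℤ) (ι : J) (p : ℤ) : Prop :=
  (2 : ℤ) ∣ (p + (orbitSize σ ι : ℤ) - ξ ι)

/-- The set of all ℓ-roots (generating `𝒬_ℤ`). -/
noncomputable def lrootSet (σ : Equiv.Perm J) (ξ : J → ℤ) (c : J → J → ℤ) :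
    Set ((J × ℤ) → ℤ) :=
  {x | ∃ (ι : J) (p : ℤ), ValidLRootIdx σ ξ ι p ∧ x = lrootF σ c ι p}

/-- The ℤ-linear map `Ω_Q : ℤ^{R⁺} → 𝒫_ℤ`. -/
noncomputable def OmegaQmap (C : CartanADE J) (σ : Equiv.Perm J) (ξ : J → ℤ) {L : ℕ}
    (ii : Fin L → J) (m : (J → ℤ) → ℤ) : (J × ℤ) → ℤ :=
  ∑ k : Fin L, m (betaOf C ii k) • varpiF σ (ii k) (heightAt σ ξ ii k)

theorem pairingQ_sub_left (C : CartanADE J) (u v w : J → ℚ) :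
    pairingQ C (u - v) w = pairingQ C u w - pairingQ C v w := by
  simp only [pairingQ, Pi.sub_apply, sub_mul, Finset.sum_sub_distrib]

theorem pairingQ_smul_left (C : CartanADE J) (a : ℚ) (v w : J → ℚ) :
    pairingQ C (a • v) w = a * pairingQ C v w := by
  simp only [pairingQ, Pi.smul_apply, smul_eq_mul, Finset.mul_sum, mul_assoc]

theorem pairingQ_comm (C : CartanADE J) (v w : J → ℚ) :
    pairingQ C v w = pairingQ C w v := by
  unfold pairingQ
  rw [Finset.sum_comm]
  refine Finset.sum_congr rfl fun i _ => Finset.sum_congr rfl fun j _ => ?_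
  rw [C.symm j i]; ring

theorem pairingQ_sub_right (C : CartanADE J) (u v w : J → ℚ) :
    pairingQ C w (u - v) = pairingQ C w u - pairingQ C w v := by
  rw [pairingQ_comm, pairingQ_sub_left, pairingQ_comm C u, pairingQ_comm C v]

theorem pairingQ_smul_right (C : CartanADE J) (a : ℚ) (v w : J → ℚ) :
    pairingQ C w (a • v) = a * pairingQ C w v := by
  rw [pairingQ_comm, pairingQ_smul_left, pairingQ_comm C v]

theorem pairingQ_sum_right (C : CartanADE J) {T : Type} (s : Finset T) (f : T → J → ℚ)
    (w : J → ℚ) : pairingQ C w (∑ t ∈ s, f t) = ∑ t ∈ s, pairingQ C w (f t) := by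
  induction s using Finset.induction_on with
  | empty => simp [pairingQ]
  | insert a s ha ih =>
    rw [Finset.sum_insert ha, Finset.sum_insert ha, ← ih]
    simp only [pairingQ, Pi.add_apply, mul_add, Finset.sum_add_distrib]

/-- rational simple root -/
def eQ (ι : J) : J → ℚ := fun j => (simpleRoot ι j : ℚ)

theorem pairingQ_eQ (C : CartanADE J) (v : J → ℚ) (ι : J) :
    pairingQ C v (eQ ι) = ∑ κ : J, v κ * (C.a κ ι : ℚ) := by
  unfold pairingQ eQ simpleRoot
  refine Finset.sum_congr rfl fun i _ => ?_
  rw [Finset.sum_eq_single ι]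
  · simp
  · intro b _ hb; simp [hb]
  · simp

theorem pairingQ_eQ_self (C : CartanADE J) (ι : J) : pairingQ C (eQ ι) (eQ ι) = 2 := by
  rw [pairingQ_eQ, Finset.sum_eq_single ι]
  · simp [eQ, simpleRoot, C.diag]
  · intro b _ hb; simp [eQ, simpleRoot, hb]
  · simp

theorem reflQ_eq (C : CartanADE J) (ι : J) (v : J → ℚ) :
    reflQ C ι v = v - pairingQ C v (eQ ι) • eQ ι := by
  rw [pairingQ_eQ]
  funext j
  simp [reflQ, eQ, simpleRoot]

theorem pairingQ_reflQ (C : CartanADE J) (ι : J) (v w : J → ℚ) :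
    pairingQ C (reflQ C ι v) (reflQ C ι w) = pairingQ C v w := by
  rw [reflQ_eq, reflQ_eq]
  simp only [pairingQ_sub_left, pairingQ_sub_right, pairingQ_smul_left, pairingQ_smul_right,
    pairingQ_eQ_self]
  rw [pairingQ_comm C (eQ ι) w]
  ring

theorem pairingQ_applyReflsQ (C : CartanADE J) (l : List J) (v w : J → ℚ) :
    pairingQ C (applyReflsQ C l v) (applyReflsQ C l w) = pairingQ C v w := by
  induction l with
  | nil => rfl
  | cons a l ih =>
    rw [← ih]
    exact pairingQ_reflQ C a _ _

theorem applyRefls_cast (C : CartanADE J) (l : List J) (v : J → ℤ) :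
    (fun j => (applyRefls C l v j : ℚ)) = applyReflsQ C l (fun j => (v j : ℚ)) := by
  induction l with
  | nil => rfl
  | cons a l ih =>
    change (fun j => (reflS C a (applyRefls C l v) j : ℚ)) = reflQ C a (applyReflsQ C l _)
    rw [← ih]
    funext j
    simp [reflS, reflQ, simpleRoot]

theorem applyReflsQ_coord (C : CartanADE J) (l : List J) (v : J → ℚ) (i : J) (h : i ∉ l) :
    applyReflsQ C l v i = v i := by
  induction l with
  | nil => rfl
  | cons a l ih =>
    simp only [List.mem_cons, not_or] at h
    change reflQ C a (applyReflsQ C l v) i = v i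
    simp [reflQ, h.1, ih h.2]

theorem pairingQ_fund (C : CartanADE J) (Λ : J → J → ℚ) (hΛ : IsFundWeights C Λ) (ι : J)
    (v : J → ℚ) : pairingQ C (Λ ι) v = v ι := by
  have hv : v = ∑ j : J, v j • eQ j := by
    funext i
    simp [Finset.sum_apply, eQ, simpleRoot]
  have h : ∀ j, pairingQ C (Λ ι) (eQ j) = if ι = j then 1 else 0 := hΛ ι
  conv_lhs => rw [hv]
  rw [pairingQ_sum_right]
  simp [pairingQ_smul_right, h]

theorem nuBetaPair_zero (C : CartanADE J) (L : ℕ) (ii : Fin L → J)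
    (Λ : J → J → ℚ) (hΛ : IsFundWeights C Λ)
    (k : Fin L) (hk : ∀ l : Fin L, k < l → ii l ≠ ii k) (l : Fin L) (hl : k < l) :
    nuBetaPair C ii Λ k l = 0 := by
  have hlk : k.1 < l.1 := hl
  have hsplit : (List.ofFn ii).take l.1 =
      (List.ofFn ii).take (k.1 + 1) ++ ((List.ofFn ii).take l.1).drop (k.1 + 1) := by
    conv_lhs => rw [← List.take_append_drop (k.1 + 1) ((List.ofFn ii).take l.1)]
    rw [List.take_take, min_eq_left (by omega)]
  have hnot : ii k ∉ ((List.ofFn ii).take l.1).drop (k.1 + 1) := by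
    intro hm
    obtain ⟨n, hn, he⟩ := List.mem_iff_getElem.mp hm
    simp only [List.length_drop, List.length_take, List.length_ofFn] at hn
    simp only [List.getElem_drop, List.getElem_take, List.getElem_ofFn] at he
    exact hk _ (by change k.1 < k.1 + 1 + n; omega) he
  have hb : betaQ C ii l = applyReflsQ C ((List.ofFn ii).take (k.1 + 1))
      (applyReflsQ C (((List.ofFn ii).take l.1).drop (k.1 + 1)) (eQ (ii l))) := by
    have h1 : betaQ C ii l = applyReflsQ C ((List.ofFn ii).take l.1) (eQ (ii l)) :=
      applyRefls_cast C _ _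
    rw [h1, hsplit]
    simp [applyReflsQ, List.foldr_append]
  have hn : nuOf C ii Λ k =
      (-1 : ℚ) • applyReflsQ C ((List.ofFn ii).take (k.1 + 1)) (Λ (ii k)) := by
    simp [nuOf]
  rw [nuBetaPair, hn, hb, pairingQ_smul_left, pairingQ_applyReflsQ, pairingQ_fund C Λ hΛ,
    applyReflsQ_coord C _ _ _ hnot]
  simp [eQ, simpleRoot, (hk l hl).symm]

/-- if the letter `ι_k` does not occur after position `k` in the reduced
word, then `(ν_k, β_l) = 0` for all `l > k`; consequently, for every `β` and every
`𝐦 ∈ KP(β)`, `Σ_{t ≤ k} 𝐦(β_t)(ν_k, β_t) = (ν_k, β)`. -/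
theorem statement10 (C : CartanADE J) (L : ℕ) (ii : Fin L → J)
    (hii : IsReducedWord C ii) (Λ : J → J → ℚ) (hΛ : IsFundWeights C Λ)
    (k : Fin L) (hk : ∀ l : Fin L, k < l → ii l ≠ ii k) :
    (∀ l : Fin L, k < l → nuBetaPair C ii Λ k l = 0) ∧
    (∀ β : J → ℤ, (∀ ι : J, 0 ≤ β ι) → ∀ m : (J → ℤ) → ℤ, IsKP C β m →
        rhoOf C ii Λ m k = pairingQ C (nuOf C ii Λ k) (fun j => (β j : ℚ))) := by
  have h0 := nuBetaPair_zero C L ii Λ hΛ k hk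
  refine ⟨h0, fun β _ m hm => ?_⟩
  obtain ⟨hL, hinj, hmem⟩ := hii
  have hfin : (posRoots C).Finite := by
    apply Set.finite_of_ncard_ne_zero
    have := k.2
    omega
  have hrange : Set.range (betaOf C ii) = posRoots C := by
    apply Set.eq_of_subset_of_ncard_le _ _ hfin
    · rintro _ ⟨t, rfl⟩; exact hmem t
    · rw [← hL, ← Set.image_univ, Set.ncard_image_of_injective _ hinj, Set.ncard_univ]
      simp
  have hβ : (fun j => (β j : ℚ)) = ∑ t : Fin L, (m (betaOf C ii t) : ℚ) • betaQ C ii t := by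
    rw [← hm.2.2, ← hrange, finsum_mem_range hinj, finsum_eq_sum_of_fintype]
    funext j
    simp [Finset.sum_apply, betaQ]
  rw [hβ, pairingQ_sum_right, rhoOf]
  simp only [pairingQ_smul_right]
  apply Finset.sum_subset (Finset.filter_subset _ _)
  intro t _ ht
  have : k < t := by simpa using ht
  have h := h0 t this
  rw [nuBetaPair] at h
  rw [nuBetaPair, h, mul_zero]
end QDatumPaper
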